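/- Let k be a finite field with q elements and let f₁, …, f_r be homogeneous polynomials in k[x₀, …, x_n] of degrees d₁, …, d_r respectively, with each dᵢ ≥ 1 and d₁ + ⋯ + d_r ≤ n. Then the number of points of the projective space ℙⁿ(k) (the projectivization of the vector space k^{n+1}) at which all the polynomials f₁, …, f_r vanish is congruent to 1 modulo q. -/

import Mathlib

open scoped LinearAlgebra.Projectivization

open Finset

/-- The base-`p` digits of `u`, placed cyclically in positions modulo `m` and rotated by `t`,
are the digits of a number `w t`. -/
theorem exists_digit_rotation {p m : ℕ} (hp : 1 < p) (u : ℕ) :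
    ∃ w : ℕ → ℕ, (∀ t, w t ≡ p ^ t * u [MOD p ^ m - 1]) ∧ (∀ t, w (t + m) = w t) ∧
      ∑ t ∈ range m, w t = (p.digits u).sum * ∑ t ∈ range m, p ^ t ∧
      (u ≠ 0 → ∀ t, 0 < w t) := by
  induction u using Nat.strong_induction_on with
  | _ u ih =>
  obtain rfl | hu := eq_or_ne u 0
  · exact ⟨0, by simp [Nat.ModEq]⟩
  obtain ⟨w, hmod, hper, hsum, hpos⟩ := ih (u / p) (Nat.div_lt_self (by lia) hp)
  have hshift : ∑ t ∈ range m, w (t + 1) = ∑ t ∈ range m, w t := by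
    have h₁ := sum_range_succ w m
    have h₂ := sum_range_succ' w m
    have h₃ : w m = w 0 := by simpa using hper 0
    lia
  have hone : p ^ m ≡ 1 [MOD p ^ m - 1] :=
    ((Nat.modEq_iff_dvd' (Nat.one_le_pow _ _ (by lia))).2 dvd_rfl).symm
  have hrot (t : ℕ) : p ^ (t % m) ≡ p ^ t [MOD p ^ m - 1] := by
    conv_rhs => rw [← Nat.mod_add_div t m, pow_add, pow_mul]
    simpa using ((hone.pow (t / m)).mul_left (p ^ (t % m))).symm
  refine ⟨fun t ↦ u % p * p ^ (t % m) + w (t + 1), fun t ↦ ?_, fun t ↦ ?_, ?_, fun _ t ↦ ?_⟩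
  · have key : p ^ t * u = u % p * p ^ t + p ^ (t + 1) * (u / p) := by
      conv_lhs => rw [← Nat.mod_add_div u p]
      ring
    rw [key]
    exact ((hrot t).mul_left _).add (hmod (t + 1))
  · simp only [Nat.add_mod_right, add_right_comm t m, hper]
  · rw [sum_add_distrib, hshift, hsum, Nat.digits_def' hp (Nat.pos_of_ne_zero hu), List.sum_cons,
      add_mul, ← mul_sum]
    congr 2
    exact sum_congr rfl fun t ht ↦ by rw [Nat.mod_eq_of_lt (mem_range.1 ht)]
  · obtain h | h := eq_or_ne (u / p) 0
    · have : 0 < u % p := by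
        rw [Nat.mod_eq_of_lt ((Nat.div_eq_zero_iff.1 h).resolve_left (by lia))]
        exact Nat.pos_of_ne_zero hu
      positivity
    · exact Nat.add_pos_right _ (hpos h _)

/-- If every monomial exponent `v j` has degree less than the number of variables and the product
of the monomials with multiplicities `u j` has all its exponents nonzero and divisible by
`p ^ m - 1`, then the total `p`-adic digit sum of the multiplicities is large. -/
theorem two_mul_le_sum_digits_sum {p m : ℕ} (hp : 1 < p) (hm : m ≠ 0) {ι σ : Type*} [Fintype σ]
    [Nonempty σ] (s : Finset ι) (v : ι → σ → ℕ) (hv : ∀ j ∈ s, ∑ i, v j i < Fintype.card σ) (u : ι → ℕ)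
    (hu : p ^ m - 1 ∣ ∑ j ∈ s, u j)
    (hdvd : ∀ i, p ^ m - 1 ∣ ∑ j ∈ s, u j * v j i) (hne : ∀ i, ∑ j ∈ s, u j * v j i ≠ 0) :
    2 * m * (p - 1) ≤ ∑ j ∈ s, (p.digits (u j)).sum := by
  choose w hmod _ hsum hpos using fun j ↦ exists_digit_rotation (m := m) hp (u j)
  have hq : 0 < p ^ m - 1 := Nat.sub_pos_of_lt (Nat.one_lt_pow hm hp)
  have hdvd' (t : ℕ) (c : ι → ℕ) (hc : p ^ m - 1 ∣ ∑ j ∈ s, u j * c j) :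
      p ^ m - 1 ∣ ∑ j ∈ s, w j t * c j := by
    have : ∑ j ∈ s, w j t * c j ≡ p ^ t * ∑ j ∈ s, u j * c j [MOD p ^ m - 1] := by
      rw [mul_sum]
      refine Nat.ModEq.sum fun j _ ↦ ?_
      rw [← mul_assoc]
      exact (hmod j t).mul_right _
    exact (this.dvd_iff dvd_rfl).2 (hc.mul_left _)
  have hle (t : ℕ) : 2 * (p ^ m - 1) ≤ ∑ j ∈ s, w j t := by
    have h₁ (i : σ) : p ^ m - 1 ≤ ∑ j ∈ s, w j t * v j i := by
      refine Nat.le_of_dvd ?_ (hdvd' t _ (hdvd i))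
      obtain ⟨j, hj, hji⟩ := exists_ne_zero_of_sum_ne_zero (hne i)
      exact sum_pos' (fun _ _ ↦ Nat.zero_le _) ⟨j, hj, Nat.mul_pos
        (hpos j (left_ne_zero_of_mul hji) t) (Nat.pos_of_ne_zero (right_ne_zero_of_mul hji))⟩
    obtain ⟨c, hc⟩ : p ^ m - 1 ∣ ∑ j ∈ s, w j t := by
      simpa using hdvd' t 1 (by simpa using hu)
    have h₂ : Fintype.card σ * (p ^ m - 1) ≤ (Fintype.card σ - 1) * ∑ j ∈ s, w j t := by
      calc Fintype.card σ * (p ^ m - 1) = ∑ _i : σ, (p ^ m - 1) := by simp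
        _ ≤ ∑ i, ∑ j ∈ s, w j t * v j i := sum_le_sum fun i _ ↦ h₁ i
        _ = ∑ j ∈ s, w j t * ∑ i, v j i := by rw [sum_comm]; simp_rw [mul_sum]
        _ ≤ ∑ j ∈ s, w j t * (Fintype.card σ - 1) :=
          sum_le_sum fun j hj ↦ Nat.mul_le_mul_left _ (Nat.le_sub_one_of_lt (hv j hj))
        _ = _ := by rw [← sum_mul, mul_comm]
    rw [hc] at h₂ ⊢
    have hc₂ : Fintype.card σ ≤ (Fintype.card σ - 1) * c :=
      Nat.le_of_mul_le_mul_left (by linarith) hq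
    have hcard : 0 < Fintype.card σ := Fintype.card_pos
    have : 2 ≤ c := by
      by_contra! h
      have := hc₂.trans (Nat.mul_le_mul_left _ (Nat.le_of_lt_succ h))
      lia
    rw [mul_comm]
    exact Nat.mul_le_mul_left _ this
  have hG : (p - 1) * ∑ t ∈ range m, p ^ t = p ^ m - 1 := by
    rw [mul_comm]
    exact geom_sum_mul_of_one_le hp.le m
  have hG₀ : 0 < ∑ t ∈ range m, p ^ t := Nat.pos_of_mul_pos_left (hG ▸ hq)
  refine Nat.le_of_mul_le_mul_right ?_ hG₀
  calc 2 * m * (p - 1) * ∑ t ∈ range m, p ^ t = ∑ _t ∈ range m, 2 * (p ^ m - 1) := by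
        rw [mul_assoc, hG, sum_const, card_range, smul_eq_mul]
        ring
    _ ≤ ∑ t ∈ range m, ∑ j ∈ s, w j t := sum_le_sum fun t _ ↦ hle t
    _ = _ := by rw [sum_comm, sum_mul, sum_congr rfl fun j _ ↦ hsum j]

theorem sum_digits_pow_sub_one {p : ℕ} (hp : 1 < p) (m : ℕ) :
    (p.digits (p ^ m - 1)).sum = m * (p - 1) := by
  induction m with
  | zero => simp
  | succ m ih =>
    have h : p ^ (m + 1) - 1 = (p - 1) + p * (p ^ m - 1) := by
      have := Nat.one_le_pow m p (by lia)
      zify [this, Nat.one_le_pow (m + 1) p (by lia), hp.le]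
      ring
    rw [h]
    obtain rfl | hm := eq_or_ne m 0
    · simp [Nat.digits_of_lt p (p - 1) (by lia) (by lia)]
    · have := Nat.one_lt_pow hm hp
      rw [Nat.digits_add p hp _ _ (by lia) (by lia), List.sum_cons, ih]
      ring

theorem sum_digits_pow_mul {p : ℕ} (hp : 1 < p) (a n : ℕ) :
    (p.digits (p ^ a * n)).sum = (p.digits n).sum := by
  obtain rfl | hn := Nat.eq_zero_or_pos n
  · simp
  · simp [Nat.digits_base_pow_mul hp hn]

theorem padicValNat_prod_of_ne_zero {p : ℕ} [Fact p.Prime] {ι : Type*} (s : Finset ι) (a : ι → ℕ)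
    (ha : ∀ j ∈ s, a j ≠ 0) : padicValNat p (∏ j ∈ s, a j) = ∑ j ∈ s, padicValNat p (a j) := by
  classical
  induction s using Finset.induction with
  | empty => simp
  | insert j s hj ih =>
    rw [forall_mem_insert] at ha
    rw [prod_insert hj, sum_insert hj, padicValNat.mul ha.1 (prod_ne_zero_iff.2 ha.2), ih ha.2]

theorem pow_dvd_multinomial {p m : ℕ} [Fact p.Prime] {ι : Type*} (s : Finset ι) (u : ι → ℕ)
    (h : (p.digits (∑ j ∈ s, u j)).sum + m * (p - 1) ≤ ∑ j ∈ s, (p.digits (u j)).sum) :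
    p ^ m ∣ Nat.multinomial s u := by
  have hp : p.Prime := Fact.out
  have hfac (n : ℕ) : (p - 1) * padicValNat p n.factorial + (p.digits n).sum = n := by
    rw [sub_one_mul_padicValNat_factorial, Nat.sub_add_cancel (Nat.digit_sum_le p n)]
  have hval : ∑ j ∈ s, padicValNat p (u j).factorial + padicValNat p (Nat.multinomial s u) =
      padicValNat p (∑ j ∈ s, u j).factorial := by
    rw [← Nat.multinomial_spec, padicValNat.mul (prod_ne_zero_iff.2 fun j _ ↦
      Nat.factorial_ne_zero _) (Nat.multinomial_pos s u).ne', padicValNat_prod_of_ne_zero s _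
      fun j _ ↦ Nat.factorial_ne_zero _]
  have hsum := sum_congr rfl fun j (_ : j ∈ s) ↦ hfac (u j)
  rw [sum_add_distrib, ← mul_sum] at hsum
  have := hfac (∑ j ∈ s, u j)
  rw [padicValNat_dvd_iff_le (Nat.multinomial_pos s u).ne']
  rw [← hval] at this
  refine (Nat.mul_le_mul_left_iff (Nat.sub_pos_of_lt hp.one_lt)).1 ?_
  lia

theorem sum_pow_eq_zero_of_not_dvd {k R : Type*} [Field k] [Fintype k] [CommRing R] [IsDomain R]
    (τ : k →* R) (hτ : Function.Injective τ) {a : ℕ}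
    (ha : ¬ Fintype.card k - 1 ∣ a) : ∑ x, τ x ^ a = 0 := by
  classical
  obtain ⟨g, hg⟩ := IsCyclic.exists_generator (α := kˣ)
  have hga : (g : k) ^ a ≠ 1 := fun h ↦ ha <| by
    rw [← Nat.card_eq_fintype_card, ← Nat.card_units, ← orderOf_eq_card_of_forall_mem_zpowers hg,
      orderOf_dvd_iff_pow_eq_one]
    exact Units.ext (by simpa using h)
  have hτg : τ g ^ a ≠ 1 := fun h ↦ hga <| hτ (by rw [map_pow, h, map_one])
  by_contra hsum
  refine hτg ((mul_eq_right₀ hsum).1 ?_)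
  rw [mul_sum]
  exact Fintype.sum_equiv (Equiv.mulLeft₀ (g : k) g.ne_zero) _ _ fun x ↦ by simp [mul_pow]

theorem card_dvd_sum_prod_pow {k R σ : Type*} [Field k] [Fintype k] [CommRing R] [IsDomain R]
    [Fintype σ] [DecidableEq σ] (τ : k →* R) (hτ : Function.Injective τ) (a : σ → ℕ)
    (ha : ∃ i, Fintype.card k - 1 ∣ a i → a i = 0) :
    (Fintype.card k : R) ∣ ∑ x : σ → k, ∏ i, τ (x i) ^ a i := by
  rw [← Fintype.prod_sum fun i (y : k) ↦ τ y ^ a i]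
  obtain ⟨i, hi⟩ := ha
  refine dvd_trans ?_ (dvd_prod_of_mem _ (mem_univ i))
  by_cases h : Fintype.card k - 1 ∣ a i
  · simp [hi h]
  · simp [sum_pow_eq_zero_of_not_dvd τ hτ h]

/-- Ax's divisibility, for the power of a polynomial of low degree summed over multiplicative
representatives of a finite field. -/
theorem pow_dvd_sum_eval_pow {p m : ℕ} [Fact p.Prime] (hm : m ≠ 0) {k R σ : Type*} [Field k]
    [Fintype k] (hk : Fintype.card k = p ^ m) [CommRing R] [IsDomain R] [Fintype σ] [DecidableEq σ]
    (τ : k →* R) (hτ : Function.Injective τ) (F : MvPolynomial σ R)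
    (hF : F.totalDegree < Fintype.card σ) :
    (p : R) ^ m ∣
      ∑ x : σ → k, MvPolynomial.eval (τ ∘ x) F ^ ((p ^ m - 1) * p ^ (m - 1)) := by
  have hp : 1 < p := (Fact.out : p.Prime).one_lt
  have : Nonempty σ := Fintype.card_pos_iff.1 (Nat.zero_lt_of_lt hF)
  classical
  have hterm (u : (σ →₀ ℕ) → ℕ) (x : σ → k) :
      ∏ v ∈ F.support, (F.coeff v * ∏ i, τ (x i) ^ v i) ^ u v =
        (∏ v ∈ F.support, F.coeff v ^ u v) * ∏ i, τ (x i) ^ ∑ v ∈ F.support, u v * v i := by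
    simp_rw [mul_pow, prod_mul_distrib, ← prod_pow, ← prod_pow_eq_pow_sum]
    rw [prod_comm]
    simp_rw [← pow_mul, mul_comm]
  simp_rw [MvPolynomial.eval_eq', Function.comp_apply, sum_pow_eq_sum_piAntidiag, hterm]
  rw [sum_comm]
  refine dvd_sum fun u hu ↦ ?_
  rw [mem_piAntidiag] at hu
  rw [← mul_sum, ← mul_sum]
  by_cases ha : ∃ i, Fintype.card k - 1 ∣ ∑ v ∈ F.support, u v * v i →
      ∑ v ∈ F.support, u v * v i = 0
  · have := card_dvd_sum_prod_pow τ hτ _ ha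
    rw [hk, Nat.cast_pow] at this
    exact (this.mul_left _).mul_left _
  · push Not at ha
    rw [hk] at ha
    refine Dvd.dvd.mul_right ?_ _
    rw [← Nat.cast_pow]
    refine Nat.cast_dvd_cast (pow_dvd_multinomial _ _ ?_)
    have h := two_mul_le_sum_digits_sum hp hm F.support (fun v i ↦ v i) (fun v hv ↦ ?_) u
      (hu.1 ▸ dvd_mul_right _ _) (fun i ↦ (ha i).1) fun i ↦ (ha i).2
    · rw [hu.1, mul_comm, sum_digits_pow_mul hp, sum_digits_pow_sub_one hp]
      linarith
    · refine lt_of_le_of_lt ?_ hF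
      simpa [Finsupp.sum_fintype] using MvPolynomial.le_totalDegree hv

theorem MvPolynomial.exists_map_eq_totalDegree_le {R S σ : Type*} [CommRing R] [CommRing S]
    {φ : R →+* S} (hφ : Function.Surjective φ) (f : MvPolynomial σ S) :
    ∃ F : MvPolynomial σ R, F.map φ = f ∧ F.totalDegree ≤ f.totalDegree := by
  refine ⟨∑ v ∈ f.support, monomial v (Function.surjInv hφ (f.coeff v)), ?_,
    totalDegree_finsetSum_le fun v hv ↦ (totalDegree_monomial_le _ _).trans (le_totalDegree hv)⟩
  simp_rw [map_sum, map_monomial, Function.surjInv_eq hφ]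
  exact f.support_sum_monomial_coeff

namespace WittVector

variable {p : ℕ} [Fact p.Prime] {k : Type*} [Field k] [CharP k p] [PerfectRing k p]

theorem p_dvd_iff_constantCoeff_eq_zero (y : WittVector p k) :
    (p : WittVector p k) ∣ y ↔ constantCoeff y = 0 := by
  rw [← Ideal.mem_span_singleton, mem_span_p_iff_coeff_zero_eq_zero, constantCoeff_apply]

theorem p_pow_dvd_natCast_iff {m N : ℕ} : (p : WittVector p k) ^ m ∣ N ↔ p ^ m ∣ N := by
  refine ⟨fun h ↦ ?_, fun h ↦ by simpa using Nat.cast_dvd_cast (α := WittVector p k) h⟩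
  induction m generalizing N with
  | zero => simp
  | succ m ih =>
    obtain ⟨N, rfl⟩ : p ∣ N := by
      have := (p_dvd_iff_constantCoeff_eq_zero _).1 ((dvd_pow_self _ m.succ_ne_zero).trans h)
      rwa [map_natCast, CharP.cast_eq_zero_iff k p] at this
    rw [Nat.cast_mul, pow_succ', mul_dvd_mul_iff_left (p_nonzero p k)] at h
    rw [pow_succ']
    exact mul_dvd_mul_left _ (ih h)

theorem p_pow_dvd_pow_sub [Fintype k] [DecidableEq k] {m : ℕ} (hm : m ≠ 0)
    (hk : Fintype.card k = p ^ m) (y : WittVector p k) :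
    (p : WittVector p k) ^ m ∣
      y ^ ((p ^ m - 1) * p ^ (m - 1)) - if constantCoeff y = 0 then 0 else 1 := by
  have hp : 1 < p := (Fact.out : p.Prime).one_lt
  split_ifs with hy
  · rw [sub_zero]
    refine (pow_dvd_pow_of_dvd ((p_dvd_iff_constantCoeff_eq_zero y).2 hy) m).trans
      (pow_dvd_pow _ ?_)
    have h₁ := Nat.lt_pow_self hp (n := m - 1)
    have h₂ := Nat.le_mul_of_pos_left (p ^ (m - 1)) (Nat.sub_pos_of_lt (Nat.one_lt_pow hm hp))
    lia
  · have h : (p : WittVector p k) ∣ y ^ (p ^ m - 1) - 1 := by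
      rw [p_dvd_iff_constantCoeff_eq_zero, map_sub, map_pow, map_one, ← hk,
        FiniteField.pow_card_sub_one_eq_one _ hy, sub_self]
    have := dvd_sub_pow_of_dvd_sub h (m - 1)
    rwa [one_pow, ← pow_mul, Nat.sub_add_cancel (Nat.one_le_iff_ne_zero.2 hm)] at this

end WittVector

/-- **Ax's theorem** for a system of polynomials: if the sum of the total degrees is less than the
number of variables, then the number of elements of the field divides the number of common
zeros. -/
theorem card_dvd_card_solutions {k σ ι : Type*} [Field k] [Fintype k] [Fintype σ]
    [Fintype ι] (f : ι → MvPolynomial σ k) (hf : ∑ i, (f i).totalDegree < Fintype.card σ) :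
    Fintype.card k ∣ Nat.card {x : σ → k // ∀ i, MvPolynomial.eval x (f i) = 0} := by
  classical
  obtain ⟨p, hchar⟩ := CharP.exists k
  obtain ⟨⟨m, hm⟩, hp, hk⟩ := FiniteField.card k p
  have : Fact p.Prime := ⟨hp⟩
  simp only [PNat.mk_coe] at hk
  choose F hFf hFdeg using fun i ↦ MvPolynomial.exists_map_eq_totalDegree_le
    (WittVector.constantCoeff_surjective (R := k) p) (f i)
  let τ : k →* WittVector p k := WittVector.teichmuller p
  have hτ (x : k) : WittVector.constantCoeff (τ x) = x := WittVector.teichmuller_coeff_zero p x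
  have hτinj : Function.Injective τ := Function.LeftInverse.injective hτ
  set E := (p ^ m - 1) * p ^ (m - 1)
  have heval (i : ι) (x : σ → k) :
      WittVector.constantCoeff (MvPolynomial.eval (τ ∘ x) (F i)) = MvPolynomial.eval x (f i) := by
    rw [MvPolynomial.map_eval, hFf]
    congr 2
  have hdvd : (p : WittVector p k) ^ m ∣
      ∑ x : σ → k, ∏ i, (1 - MvPolynomial.eval (τ ∘ x) (F i) ^ E) := by
    simp_rw [prod_sub, prod_const_one, mul_one, prod_pow, ← map_prod]
    rw [sum_comm]
    refine dvd_sum fun t _ ↦ ?_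
    rw [← mul_sum]
    refine (pow_dvd_sum_eval_pow hm.ne' hk τ hτinj _ (lt_of_le_of_lt ?_ hf)).mul_left _
    calc (∏ i ∈ t, F i).totalDegree ≤ ∑ i ∈ t, (F i).totalDegree :=
          MvPolynomial.totalDegree_finsetProd t F
      _ ≤ ∑ i ∈ t, (f i).totalDegree := sum_le_sum fun i _ ↦ hFdeg i
      _ ≤ ∑ i, (f i).totalDegree := sum_le_univ_sum_of_nonneg fun _ ↦ Nat.zero_le _
  rw [hk, ← WittVector.p_pow_dvd_natCast_iff (k := k), ← Ideal.mem_span_singleton,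
    ← Ideal.Quotient.eq_zero_iff_mem]
  rw [← Ideal.mem_span_singleton, ← Ideal.Quotient.eq_zero_iff_mem] at hdvd
  rw [← hdvd, Nat.card_eq_fintype_card, Fintype.card_subtype, ← sum_boole, map_sum, map_sum]
  refine sum_congr rfl fun x _ ↦ ?_
  have hpow (i : ι) :
      Ideal.Quotient.mk (Ideal.span {(p : WittVector p k) ^ m})
          (MvPolynomial.eval (τ ∘ x) (F i) ^ E) =
        if MvPolynomial.eval x (f i) = 0 then 0 else 1 := by
    have := WittVector.p_pow_dvd_pow_sub hm.ne' hk (MvPolynomial.eval (τ ∘ x) (F i))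
    rw [← Ideal.mem_span_singleton, ← Ideal.Quotient.eq_zero_iff_mem, map_sub, sub_eq_zero,
      heval] at this
    rw [this]
    split_ifs <;> simp
  simp_rw [map_prod, map_sub, map_one, hpow]
  split_ifs with hx
  · simp [hx]
  · push Not at hx
    obtain ⟨i, hi⟩ := hx
    rw [map_zero, eq_comm]
    exact prod_eq_zero (mem_univ i) (by simp [hi])

theorem MvPolynomial.IsHomogeneous.eval_smul {R σ : Type*} [CommRing R] [Fintype σ]
    {f : MvPolynomial σ R} {d : ℕ} (hf : f.IsHomogeneous d) (c : R) (x : σ → R) :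
    eval (c • x) f = c ^ d * eval x f := by
  rw [eval_eq', eval_eq', mul_sum]
  refine sum_congr rfl fun v hv ↦ ?_
  have hd : ∑ i, v i = d := by
    rw [← Finsupp.degree_eq_sum]
    exact (Finsupp.degree_eq_weight_one (R := ℕ) ▸ hf (mem_support_iff.1 hv))
  simp_rw [Pi.smul_apply, smul_eq_mul, mul_pow, prod_mul_distrib, prod_pow_eq_pow_sum, hd]
  ring

theorem Projectivization.card_cone {k V : Type*} [Field k] [Finite k] [AddCommGroup V] [Module k V]
    [Finite V] (P : V → Prop) (hP : ∀ (c : kˣ) v, P v → P (c • v)) (h0 : P 0) :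
    Nat.card {v // P v} = Nat.card {p : Projectivization k V // P p.rep} * (Nat.card k - 1) + 1 := by
  classical
  let e : {p : Projectivization k V // P p.rep} × kˣ → {v : {v // P v} // v ≠ ⟨0, h0⟩} :=
    fun x ↦ ⟨⟨x.2 • x.1.1.rep, hP _ _ x.1.2⟩, fun h ↦
      x.1.1.rep_nonzero ((smul_eq_zero_iff_eq _).1 (congrArg Subtype.val h))⟩
  have he : Function.Bijective e := by
    constructor
    · rintro ⟨⟨a, ha⟩, c⟩ ⟨⟨b, hb⟩, c'⟩ h
      have h : c • a.rep = c' • b.rep := congrArg (fun v ↦ v.1.1) h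
      obtain rfl : a = b := by
        rw [← a.mk_rep, ← b.mk_rep, mk_eq_mk_iff]
        exact ⟨c⁻¹ * c', by rw [mul_smul, ← h, inv_smul_smul]⟩
      have : (c : k) = c' := smul_left_injective k a.rep_nonzero h
      rw [Units.ext this]
    · rintro ⟨⟨v, hv⟩, hne⟩
      have hv0 : v ≠ 0 := fun h ↦ hne (Subtype.ext h)
      obtain ⟨c, hc⟩ := exists_smul_eq_mk_rep k v hv0
      exact ⟨⟨⟨mk k v hv0, hc ▸ hP c v hv⟩, c⁻¹⟩, by simp [e, ← hc]⟩
  rw [← Nat.card_units, ← Nat.card_prod, Nat.card_congr (Equiv.ofBijective e he),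
    ← Finite.card_option, Nat.card_congr (Equiv.optionSubtypeNe _)]

/-- **Chevalley–Warning for projective space.**  Let `k` be a finite field and let
`f₁, …, f_r` be homogeneous polynomials in `k[x₀, …, x_n]` of degrees `d₁, …, d_r`
with each `dᵢ ≥ 1` and `d₁ + ⋯ + d_r ≤ n`.  Then the number of points of `ℙⁿ(k)` at
which all the `fᵢ` vanish is congruent to `1` modulo `|k|`. -/
theorem projective_chevalley_warning
    (k : Type) [Field k] [Fintype k] (n r : ℕ)
    (f : Fin r → MvPolynomial (Fin (n + 1)) k) (d : Fin r → ℕ)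
    (hhom : ∀ i, (f i).IsHomogeneous (d i))
    (hd : ∀ i, 1 ≤ d i) (hsum : ∑ i, d i ≤ n) :
    Nat.card {p : Projectivization k (Fin (n + 1) → k) //
        ∀ i, MvPolynomial.eval p.rep (f i) = 0} ≡ 1 [MOD Fintype.card k] := by
  have hzero : ∀ i, MvPolynomial.eval (0 : Fin (n + 1) → k) (f i) = 0 := fun i ↦ by
    simpa [zero_pow (Nat.one_le_iff_ne_zero.1 (hd i))] using (hhom i).eval_smul 0 0
  have hcard := Projectivization.card_cone (k := k)
    (fun v : Fin (n + 1) → k ↦ ∀ i, MvPolynomial.eval v (f i) = 0)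
    (fun c v hv i ↦ by rw [Units.smul_def, (hhom i).eval_smul, hv i, mul_zero]) hzero
  have hdvd := card_dvd_card_solutions f <| by
    rw [Fintype.card_fin]
    exact Nat.lt_succ_of_le ((sum_le_sum fun i _ ↦ (hhom i).totalDegree_le).trans hsum)
  rw [hcard, Nat.card_eq_fintype_card (α := k)] at hdvd
  have hq : 1 ≤ Fintype.card k := Fintype.card_pos
  rw [Nat.modEq_iff_dvd]
  zify [hq] at hdvd
  rw [mul_sub_one, sub_add, dvd_sub_right (dvd_mul_left _ _), dvd_sub_comm] at hdvd
  exact_mod_cast hdvd
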